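/- Let $F$ be a non-degenerate homogeneous polynomial map of degree $d\ge2$ on $\mathbb{C}^N$. Then for every $x\in\mathbb{C}^N\setminus\{0\}$ the limit $G_F(x):=\lim_{n\to\infty}d^{-n}\log\|F^n(x)\|_\infty$ exists in $\mathbb{R}$; moreover there is a constant $K\ge0$ such that $|G_F(x)-d^{-n}\log\|F^n(x)\|_\infty|\le K\,d^{-n}$ for all $n\ge0$ and all $x\ne0$ (in particular the convergence is uniform on $\mathbb{C}^N\setminus\{0\}$), and the function $G_F$ is continuous on $\mathbb{C}^N\setminus\{0\}$. -/

import Mathlib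

/-- `F : ℂ^N → ℂ^M` is a homogeneous polynomial map of degree `d` if each of its
coordinates is given by a homogeneous polynomial of degree `d` in `N` complex variables. -/
def IsHomPolyMap {N M : ℕ} (d : ℕ) (F : (Fin N → ℂ) → (Fin M → ℂ)) : Prop :=
  ∃ p : Fin M → MvPolynomial (Fin N) ℂ,
    (∀ i, (p i).IsHomogeneous d) ∧ ∀ x i, F x i = MvPolynomial.eval x (p i)

open Filter Topology

lemma MvPolynomial.IsHomogeneous.eval_smul {σ R : Type*} [CommSemiring R] {p : MvPolynomial σ R}
    {d : ℕ} (hp : p.IsHomogeneous d) (c : R) (x : σ → R) :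
    MvPolynomial.eval (c • x) p = c ^ d * MvPolynomial.eval x p := by
  rw [MvPolynomial.eval_eq, MvPolynomial.eval_eq, Finset.mul_sum]
  refine Finset.sum_congr rfl fun m hm => ?_
  have hdeg : ∑ i ∈ m.support, m i = d := by
    rw [← hp (MvPolynomial.mem_support_iff.mp hm)]
    simp [Finsupp.weight_apply, Finsupp.sum]
  simp only [Pi.smul_apply, smul_eq_mul, mul_pow, Finset.prod_mul_distrib,
    Finset.prod_pow_eq_pow_sum, hdeg]
  ring

namespace IsHomPolyMap

variable {N M d : ℕ} {F : (Fin N → ℂ) → (Fin M → ℂ)}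

lemma continuous (hF : IsHomPolyMap d F) : Continuous F := by
  obtain ⟨p, -, hp⟩ := hF
  refine continuous_pi fun i => ?_
  simp only [hp]
  exact (p i).continuous_eval

lemma map_smul (hF : IsHomPolyMap d F) (c : ℂ) (x : Fin N → ℂ) : F (c • x) = c ^ d • F x := by
  obtain ⟨p, hhom, hp⟩ := hF
  ext i
  simp [hp, (hhom i).eval_smul]

/-- A non-degenerate homogeneous polynomial map of degree `d` distorts `log ‖x‖` by a factor `d`,
up to a bounded error. -/
lemma exists_abs_log_norm_sub_le (hF : IsHomPolyMap d F) (hnd : ∀ x, F x = 0 → x = 0) :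
    ∃ C : ℝ, 0 ≤ C ∧ ∀ x : Fin N → ℂ, x ≠ 0 →
      |Real.log ‖F x‖ - d * Real.log ‖x‖| ≤ C := by
  have hcont : ContinuousOn (fun x => Real.log ‖F x‖) (Metric.sphere (0 : Fin N → ℂ) 1) := by
    refine hF.continuous.norm.continuousOn.log fun x hx h => ?_
    rw [hnd x (norm_eq_zero.mp h)] at hx
    simp at hx
  obtain ⟨C, hC⟩ := (isCompact_sphere (0 : Fin N → ℂ) 1).exists_bound_of_continuousOn hcont
  refine ⟨max C 0, le_max_right _ _, fun x hx => le_max_of_le_left ?_⟩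
  have hx' : ‖x‖ ≠ 0 := norm_ne_zero_iff.mpr hx
  have hmem : ((‖x‖⁻¹ : ℝ) : ℂ) • x ∈ Metric.sphere (0 : Fin N → ℂ) 1 := by
    simp [norm_smul, hx']
  have hFx : ‖F x‖ ≠ 0 := norm_ne_zero_iff.mpr fun h => hx (hnd x h)
  have hlog : Real.log ‖F (((‖x‖⁻¹ : ℝ) : ℂ) • x)‖ = Real.log ‖F x‖ - d * Real.log ‖x‖ := by
    rw [hF.map_smul, norm_smul, norm_pow, Complex.norm_real, norm_inv, norm_norm,
      Real.log_mul (pow_ne_zero _ (inv_ne_zero hx')) hFx, Real.log_pow, Real.log_inv]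
    ring
  rw [← hlog]
  exact hC _ hmem

end IsHomPolyMap

lemma iterate_ne_zero_of_forall_eq_zero {E : Type*} [Zero E] {F : E → E}
    (hnd : ∀ x, F x = 0 → x = 0) {x : E} (hx : x ≠ 0) (n : ℕ) : F^[n] x ≠ 0 := by
  induction n with
  | zero => exact hx
  | succ n ih =>
    rw [Function.iterate_succ_apply']
    exact fun h => ih (hnd _ h)

/-- for a non-degenerate homogeneous polynomial map `F` of degree `d ≥ 2`
on `ℂ^N`, the Green function `G_F(x) = lim_n d^{-n} log ‖F^n(x)‖` exists for every
`x ≠ 0`, the convergence is uniform (`|G_F(x) - d^{-n} log ‖F^n(x)‖| ≤ K d^{-n}`), and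
`G_F` is continuous on `ℂ^N \ {0}`. -/
theorem stmt6 (N d : ℕ) (hd : 2 ≤ d)
    (F : (Fin N → ℂ) → (Fin N → ℂ))
    (hF : IsHomPolyMap d F)
    (hnd : ∀ x, F x = 0 → x = 0) :
    ∃ G : (Fin N → ℂ) → ℝ,
      (∀ x : Fin N → ℂ, x ≠ 0 →
        Filter.Tendsto (fun n : ℕ => Real.log ‖F^[n] x‖ / (d : ℝ) ^ n)
          Filter.atTop (nhds (G x))) ∧
      (∃ K : ℝ, 0 ≤ K ∧ ∀ (n : ℕ) (x : Fin N → ℂ), x ≠ 0 →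
        |G x - Real.log ‖F^[n] x‖ / (d : ℝ) ^ n| ≤ K / (d : ℝ) ^ n) ∧
      ContinuousOn G {x : Fin N → ℂ | x ≠ 0} := by
  obtain ⟨C, hC0, hC⟩ := hF.exists_abs_log_norm_sub_le hnd
  have hd1 : (1 : ℝ) < d := by exact_mod_cast hd
  have hd0 : (0 : ℝ) < d := one_pos.trans hd1
  have hr : (d : ℝ)⁻¹ < 1 := inv_lt_one_of_one_lt₀ hd1
  have hstep : ∀ x : Fin N → ℂ, x ≠ 0 → ∀ n : ℕ,
      dist (Real.log ‖F^[n] x‖ / (d : ℝ) ^ n) (Real.log ‖F^[n + 1] x‖ / (d : ℝ) ^ (n + 1))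
        ≤ C * (d : ℝ)⁻¹ ^ n := by
    intro x hx n
    have hb := hC _ (iterate_ne_zero_of_forall_eq_zero hnd hx n)
    have heq : Real.log ‖F^[n + 1] x‖ / (d : ℝ) ^ (n + 1) - Real.log ‖F^[n] x‖ / (d : ℝ) ^ n
        = (Real.log ‖F (F^[n] x)‖ - d * Real.log ‖F^[n] x‖) / (d : ℝ) ^ (n + 1) := by
      rw [Function.iterate_succ_apply']
      field_simp
      ring
    rw [dist_comm, Real.dist_eq, heq, abs_div, abs_of_pos (pow_pos hd0 (n + 1)), inv_pow,
      ← div_eq_mul_inv]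
    gcongr
    · exact hd1.le
    · exact n.le_succ
  choose! G hG using fun (x : Fin N → ℂ) (hx : x ≠ 0) =>
    cauchySeq_tendsto_of_complete (cauchySeq_of_le_geometric _ _ hr (hstep x hx))
  have hbound : ∀ (n : ℕ) (x : Fin N → ℂ), x ≠ 0 →
      |G x - Real.log ‖F^[n] x‖ / (d : ℝ) ^ n| ≤ C / (1 - (d : ℝ)⁻¹) / (d : ℝ) ^ n := by
    intro n x hx
    have h := dist_le_of_le_geometric_of_tendsto _ _ hr (hstep x hx) (hG x hx) n
    rw [dist_comm, Real.dist_eq] at h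
    refine h.trans_eq ?_
    rw [inv_pow, ← div_eq_mul_inv, div_right_comm]
  refine ⟨G, hG, ⟨_, div_nonneg hC0 (sub_nonneg.mpr hr.le), hbound⟩, ?_⟩
  have hunif : TendstoUniformlyOn (fun (n : ℕ) x => Real.log ‖F^[n] x‖ / (d : ℝ) ^ n) G atTop
      {x : Fin N → ℂ | x ≠ 0} := by
    rw [Metric.tendstoUniformlyOn_iff]
    intro ε hε
    have hlim : Tendsto (fun n : ℕ => C / (1 - (d : ℝ)⁻¹) / (d : ℝ) ^ n) atTop (𝓝 0) :=
      (tendsto_pow_atTop_atTop_of_one_lt hd1).const_div_atTop _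
    filter_upwards [hlim.eventually_lt_const hε] with n hn x hx
    exact (hbound n x hx).trans_lt hn
  refine hunif.continuousOn (Frequently.of_forall fun n => ?_)
  refine ContinuousOn.div_const (ContinuousOn.log ?_ fun x hx => ?_) _
  · exact (hF.continuous.iterate n).norm.continuousOn
  · exact norm_ne_zero_iff.mpr (iterate_ne_zero_of_forall_eq_zero hnd hx n)
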